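/- Let ν > -1/2 and 0 ≤ |β| < α, and let p be the variance-gamma density with parameters (ν, α, β, 0). Then for every real k > k_* = max{-1, -2ν-1}, ∫_ℝ |x|^k p(x) dx = 2M · Σ_{j=0}^∞ (β^{2j} / (2j)!) · ∫_0^∞ t^{ν+k+2j} K_ν(α t) dt, where M = (α² - β²)^{ν+1/2} / (√π (2α)^ν Γ(ν + 1/2)); in particular, the interchange of summation over j and integration over t is valid. -/

import Mathlib

open MeasureTheory Real Filter

/-- The modified Bessel function of the second kind `K_ν(x)`. -/
noncomputable def besselK (ν x : ℝ) : ℝ :=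
  ∫ t in Set.Ioi (0 : ℝ), Real.exp (-x * Real.cosh t) * Real.cosh (ν * t)

/-- The variance-gamma density with parameters `(ν, α, β, 0)`. -/
noncomputable def vgDensity (ν α β x : ℝ) : ℝ :=
  (α ^ 2 - β ^ 2) ^ (ν + 1/2) / (Real.sqrt π * (2 * α) ^ ν * Real.Gamma (ν + 1/2)) *
    (Real.exp (β * x) * |x| ^ ν * besselK ν (α * |x|))

/-- The ascending factorial `(u)_j = u (u+1) ⋯ (u+j-1)`. -/
noncomputable def ascFactorial (u : ℝ) (j : ℕ) : ℝ := ∏ i ∈ Finset.range j, (u + i)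

/-- The Gaussian hypergeometric function `₂F₁(a, b; c; x)`. -/
noncomputable def hyp2F1 (a b c x : ℝ) : ℝ :=
  ∑' j : ℕ, ascFactorial a j * ascFactorial b j / ascFactorial c j * x ^ j / (Nat.factorial j)

lemma vg_aux_H (ν s c : ℝ) (hc : 0 < c) (hs : |ν| < s + 1) :
    Integrable (fun z : ℝ × ℝ => z.1 ^ s * Real.exp (-(c * Real.exp z.2 * z.1)) *
      Real.exp (|ν| * z.2))
      ((volume.restrict (Set.Ioi (0:ℝ))).prod (volume.restrict (Set.Ioi (0:ℝ)))) := by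
  have hs1 : 0 < s + 1 := lt_of_le_of_lt (abs_nonneg ν) hs
  have hm : Measurable (fun z : ℝ × ℝ => z.1 ^ s * Real.exp (-(c * Real.exp z.2 * z.1)) *
      Real.exp (|ν| * z.2)) := by fun_prop
  rw [integrable_prod_iff' hm.aestronglyMeasurable]
  constructor
  · refine ae_of_all _ fun u => ?_
    have h := integrableOn_rpow_mul_exp_neg_mul_rpow (p := 1) (s := s) (b := c * Real.exp u)
      (by linarith) one_pos (by positivity)
    have h' : Integrable (fun x : ℝ => x ^ s * Real.exp (-(c * Real.exp u * x)))
        (volume.restrict (Set.Ioi (0:ℝ))) := by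
      simpa [IntegrableOn] using h
    exact h'.mul_const (Real.exp (|ν| * u))
  · have h := (integrableOn_exp_mul_Ioi (a := |ν| - (s + 1)) (by linarith) 0).const_mul
      ((1 / c) ^ (s + 1) * Real.Gamma (s + 1))
    refine h.congr (ae_of_all _ fun u => ?_)
    have e := Real.integral_rpow_mul_exp_neg_mul_Ioi hs1 (r := c * Real.exp u) (by positivity)
    have e2 : ∫ t in Set.Ioi (0:ℝ), ‖t ^ s * Real.exp (-(c * Real.exp u * t)) *
        Real.exp (|ν| * u)‖ =
        ∫ t in Set.Ioi (0:ℝ), t ^ (s + 1 - 1) * Real.exp (-(c * Real.exp u * t)) *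
        Real.exp (|ν| * u) := by
      refine setIntegral_congr_fun measurableSet_Ioi fun t ht => ?_
      have ht0 : (0:ℝ) < t := ht
      have : 0 ≤ t ^ s * Real.exp (-(c * Real.exp u * t)) * Real.exp (|ν| * u) := by positivity
      simp only [Real.norm_of_nonneg this, add_sub_cancel_right]
    simp only [e2]
    rw [integral_mul_const, e]
    have e3 : (1 / (c * Real.exp u)) ^ (s + 1) = (1 / c) ^ (s + 1) * Real.exp (-u * (s + 1)) := by
      rw [Real.exp_mul, ← Real.mul_rpow (by positivity) (by positivity), Real.exp_neg]
      congr 1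
      field_simp
    rw [e3]
    have e4 : Real.exp ((|ν| - (s + 1)) * u) = Real.exp (-u * (s + 1)) * Real.exp (|ν| * u) := by
      rw [← Real.exp_add]; congr 1; ring
    rw [e4]; ring

lemma vg_aux_cosh_le (ν u : ℝ) (hu : 0 < u) : Real.cosh (ν * u) ≤ Real.exp (|ν| * u) := by
  rw [← Real.cosh_abs, abs_mul, abs_of_pos hu, Real.cosh_eq]
  have h1 : Real.exp (-(|ν| * u)) ≤ Real.exp (|ν| * u) := by
    apply Real.exp_le_exp.mpr
    have : 0 ≤ |ν| * u := by positivity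
    linarith
  linarith

lemma vg_aux_G (ν α b s : ℝ) (hb : 0 ≤ b) (hα : b < α) (hs : |ν| < s + 1) :
    IntegrableOn (fun t : ℝ => Real.exp (b * t) * (t ^ s * besselK ν (α * t)))
      (Set.Ioi (0:ℝ)) := by
  have hF : Integrable (fun z : ℝ × ℝ => Real.exp (b * z.1) * (z.1 ^ s *
      (Real.exp (-(α * z.1) * Real.cosh z.2) * Real.cosh (ν * z.2))))
      ((volume.restrict (Set.Ioi (0:ℝ))).prod (volume.restrict (Set.Ioi (0:ℝ)))) := by
    refine (vg_aux_H ν s ((α - b) / 2) (by linarith) hs).mono' ?_ ?_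
    · refine Measurable.aestronglyMeasurable ?_
      have : Measurable Real.cosh := Real.continuous_cosh.measurable
      fun_prop
    · rw [Measure.prod_restrict]
      filter_upwards [ae_restrict_mem (measurableSet_Ioi.prod measurableSet_Ioi)] with z hz
      obtain ⟨h1, h2⟩ := hz
      have h1 : 0 < z.1 := h1
      have h2 : 0 < z.2 := h2
      have hc := Real.cosh_pos (ν * z.2)
      rw [Real.norm_of_nonneg (by positivity)]
      have k1 := vg_aux_cosh_le ν z.2 h2
      have k2 : Real.exp (b * z.1) * Real.exp (-(α * z.1) * Real.cosh z.2) ≤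
          Real.exp (-((α - b) / 2 * Real.exp z.2 * z.1)) := by
        rw [← Real.exp_add]
        apply Real.exp_le_exp.mpr
        have g1 := Real.one_le_cosh z.2
        have g2 : Real.exp z.2 / 2 ≤ Real.cosh z.2 := by
          rw [Real.cosh_eq]; linarith [Real.exp_pos (-z.2)]
        have g3 : (α - b) * (Real.exp z.2 / 2) ≤ (α - b) * Real.cosh z.2 :=
          mul_le_mul_of_nonneg_left g2 (by linarith)
        have g4 : b ≤ b * Real.cosh z.2 := le_mul_of_one_le_right hb g1
        have g5 : b - α * Real.cosh z.2 ≤ - ((α - b) * (Real.exp z.2 / 2)) := by linarith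
        have := mul_le_mul_of_nonneg_right g5 h1.le
        linarith
      calc _ = z.1 ^ s * (Real.exp (b * z.1) * Real.exp (-(α * z.1) * Real.cosh z.2)) *
            Real.cosh (ν * z.2) := by ring
        _ ≤ _ := by gcongr
  have h := hF.integral_prod_left
  refine h.congr (ae_of_all _ fun t => ?_)
  simp only [besselK, integral_const_mul]

lemma vg_aux_besselK_nonneg (ν x : ℝ) : 0 ≤ besselK ν x :=
  integral_nonneg fun t => mul_nonneg (Real.exp_pos _).le (Real.cosh_pos _).le

lemma vg_aux_abs (g : ℝ → ℝ) (h : IntegrableOn g (Set.Ioi (0:ℝ))) :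
    Integrable (fun x => g |x|) := by
  rw [← integrableOn_univ, ← @Set.Iio_union_Ici _ _ (0 : ℝ), integrableOn_union,
    integrableOn_Ici_iff_integrableOn_Ioi]
  have h2 : IntegrableOn (fun x => g |x|) (Set.Ioi (0:ℝ)) :=
    h.congr_fun (fun x hx => by simp only [abs_of_pos (show (0:ℝ) < x from hx)]) measurableSet_Ioi
  refine ⟨?_, h2⟩
  rw [← (Measure.measurePreserving_neg (volume : Measure ℝ)).integrableOn_comp_preimage
      (Homeomorph.neg ℝ).measurableEmbedding]
  simpa [Function.comp_def] using h2

lemma vg_aux_series (ν α β s : ℝ) (hβ : |β| < α) (hs : |ν| < s + 1) :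
    ∑' j : ℕ, β ^ (2 * j) / (Nat.factorial (2 * j)) *
          ∫ t in Set.Ioi (0 : ℝ), t ^ (s + 2 * (j : ℝ)) * besselK ν (α * t) =
    ∫ t in Set.Ioi (0 : ℝ), Real.cosh (β * t) * (t ^ s * besselK ν (α * t)) := by
  have h0 : AEStronglyMeasurable (fun t : ℝ => t ^ s * besselK ν (α * t))
      (volume.restrict (Set.Ioi (0:ℝ))) := by
    have := (vg_aux_G ν α 0 s le_rfl (lt_of_le_of_lt (abs_nonneg β) hβ) hs).aestronglyMeasurable
    simpa using this
  have hG := vg_aux_G ν α |β| s (abs_nonneg β) hβ hs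
  have hsum : ∀ t : ℝ, HasSum (fun n : ℕ => (β * t) ^ (2 * n) / (Nat.factorial (2 * n)) *
      (t ^ s * besselK ν (α * t))) (Real.cosh (β * t) * (t ^ s * besselK ν (α * t))) :=
    fun t => (Real.hasSum_cosh (β * t)).mul_right _
  have hmeas : Measurable Real.cosh := Real.continuous_cosh.measurable
  have key := hasSum_integral_of_dominated_convergence
    (μ := volume.restrict (Set.Ioi (0:ℝ)))
    (F := fun (n : ℕ) (t : ℝ) => (β * t) ^ (2 * n) / (Nat.factorial (2 * n)) *
      (t ^ s * besselK ν (α * t)))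
    (f := fun t => Real.cosh (β * t) * (t ^ s * besselK ν (α * t)))
    (fun (n : ℕ) (t : ℝ) => (β * t) ^ (2 * n) / (Nat.factorial (2 * n)) *
      (t ^ s * besselK ν (α * t)))
    (fun n => by
      refine AEStronglyMeasurable.mul (Measurable.aestronglyMeasurable ?_) h0
      fun_prop)
    (fun n => by
      filter_upwards [ae_restrict_mem measurableSet_Ioi] with t ht
      have ht : 0 < t := ht
      have := vg_aux_besselK_nonneg ν (α * t)
      have h2 : 0 ≤ (β * t) ^ (2 * n) := (even_two_mul n).pow_nonneg _
      rw [Real.norm_of_nonneg (by positivity)])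
    (ae_of_all _ fun t => (hsum t).summable)
    (by
      simp only [(hsum _).tsum_eq]
      refine hG.mono' (AEStronglyMeasurable.mul (Measurable.aestronglyMeasurable (by fun_prop)) h0) ?_
      filter_upwards [ae_restrict_mem measurableSet_Ioi] with t ht
      have ht : 0 < t := ht
      have := vg_aux_besselK_nonneg ν (α * t)
      have h3 := vg_aux_cosh_le β t ht
      have := Real.cosh_pos (β * t)
      rw [Real.norm_of_nonneg (by positivity)]
      gcongr)
    (ae_of_all _ fun t => hsum t)
  rw [← key.tsum_eq]
  congr 1
  ext j
  rw [← integral_const_mul]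
  refine setIntegral_congr_fun measurableSet_Ioi fun t ht => ?_
  have ht : 0 < t := ht
  have e : t ^ (s + 2 * (j : ℝ)) = t ^ s * t ^ (2 * j) := by
    rw [Real.rpow_add ht, ← Real.rpow_natCast t (2 * j)]
    push_cast
    rfl
  simp only [e, mul_pow]
  ring

theorem vg_abs_moment_series_integrals (ν α β : ℝ) (hν : ν > -1/2) (hβ : |β| < α)
    (k : ℝ) (hk : k > max (-1) (-2*ν - 1)) :
    ∫ x : ℝ, |x| ^ k * vgDensity ν α β x =
      2 * ((α ^ 2 - β ^ 2) ^ (ν + 1/2) / (Real.sqrt π * (2 * α) ^ ν * Real.Gamma (ν + 1/2))) *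
        ∑' j : ℕ, β ^ (2 * j) / (Nat.factorial (2 * j)) *
          ∫ t in Set.Ioi (0 : ℝ), t ^ (ν + k + 2 * (j : ℝ)) * besselK ν (α * t) := by
  have hk1 : -1 < k := lt_of_le_of_lt (le_max_left _ _) hk
  have hk2 : -2 * ν - 1 < k := lt_of_le_of_lt (le_max_right _ _) hk
  have hs : |ν| < (ν + k) + 1 := abs_lt.mpr ⟨by linarith, by linarith⟩
  rw [vg_aux_series ν α β (ν + k) hβ hs]
  simp only [vgDensity]
  set M := (α ^ 2 - β ^ 2) ^ (ν + 1/2) / (Real.sqrt π * (2 * α) ^ ν * Real.Gamma (ν + 1/2))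
    with hM
  set q : ℝ → ℝ := fun t => t ^ (ν + k) * besselK ν (α * t) with hq
  have hG0 : Integrable (fun x : ℝ => q |x|) := by
    have := vg_aux_abs _ (vg_aux_G ν α 0 (ν + k) le_rfl (lt_of_le_of_lt (abs_nonneg β) hβ) hs)
    simpa using this
  have hG := vg_aux_abs _ (vg_aux_G ν α |β| (ν + k) (abs_nonneg β) hβ hs)
  have hI : Integrable (fun x : ℝ => Real.exp (β * x) * q |x|) := by
    refine hG.mono' (AEStronglyMeasurable.mul (Measurable.aestronglyMeasurable (by fun_prop))
      hG0.aestronglyMeasurable) (ae_of_all _ fun x => ?_)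
    have := vg_aux_besselK_nonneg ν (α * |x|)
    have h1 : 0 ≤ q |x| := by simp only [hq]; positivity
    rw [Real.norm_of_nonneg (by positivity)]
    refine mul_le_mul_of_nonneg_right (Real.exp_le_exp.mpr ?_) h1
    rw [← abs_mul]; exact le_abs_self _
  have hL : ∫ x : ℝ, |x| ^ k * (M * (Real.exp (β * x) * |x| ^ ν * besselK ν (α * |x|))) =
      M * ∫ x : ℝ, Real.exp (β * x) * q |x| := by
    rw [← integral_const_mul]
    refine integral_congr_ae ?_
    filter_upwards [compl_mem_ae_iff.mpr (measure_singleton (0:ℝ))] with x hx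
    have hx : 0 < |x| := abs_pos.mpr hx
    simp only [hq, Real.rpow_add hx]
    ring
  have hneg : ∫ x : ℝ, Real.exp (β * x) * q |x| = ∫ x : ℝ, Real.exp (-(β * x)) * q |x| := by
    rw [← integral_neg_eq_self]
    simp
  have hI' : Integrable (fun x : ℝ => Real.exp (-(β * x)) * q |x|) := by
    simpa using hI.comp_neg
  have hadd : 2 * ∫ x : ℝ, Real.exp (β * x) * q |x| =
      2 * (2 * ∫ t in Set.Ioi (0:ℝ), Real.cosh (β * t) * q t) := by
    rw [two_mul]
    nth_rewrite 2 [hneg]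
    rw [← integral_add hI hI', ← integral_comp_abs (f := fun t => Real.cosh (β * t) * q t),
      ← integral_const_mul]
    congr 1
    ext x
    have : Real.cosh (β * |x|) = Real.cosh (β * x) := by
      rw [← Real.cosh_abs, ← Real.cosh_abs (β * x)]; simp [abs_mul]
    rw [this, Real.cosh_eq]; ring
  rw [hL]
  have : ∫ x : ℝ, Real.exp (β * x) * q |x| =
      2 * ∫ t in Set.Ioi (0:ℝ), Real.cosh (β * t) * q t := by linarith
  rw [this]; ring
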